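/- Let v₁ = (−,+,+,−), v₂ = (+,+,−,+), v₃ = (+,−,−,−), v₄ = (−,−,−,−) in V. For all real numbers u₁, u₂, u₃, u₄ with u₁u₂u₃u₄ ≠ 0, there exist signs s₂, s₃, s₄ ∈ {1,−1} and an element g ∈ G such that g·(u₁•v₁ + u₂•v₂ + u₃•v₃ + u₄•v₄) = v₁ + s₂•v₂ + s₃•v₃ + s₄•v₄. -/

import Mathlib

/-- The space of real 2×2×2×2 hypermatrices. -/
abbrev V : Type := Fin 2 → Fin 2 → Fin 2 → Fin 2 → ℝ

/-- The group `SL₂(ℝ)⁴`. -/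
abbrev G : Type :=
  Matrix.SpecialLinearGroup (Fin 2) ℝ × Matrix.SpecialLinearGroup (Fin 2) ℝ ×
    Matrix.SpecialLinearGroup (Fin 2) ℝ × Matrix.SpecialLinearGroup (Fin 2) ℝ

/-- The natural linear action of `G = SL₂(ℝ)⁴` on `V`. -/
noncomputable def actG (g : G) (T : V) : V := fun i₁ i₂ i₃ i₄ =>
  ∑ j₁ : Fin 2, ∑ j₂ : Fin 2, ∑ j₃ : Fin 2, ∑ j₄ : Fin 2,
    (g.1 : Matrix (Fin 2) (Fin 2) ℝ) i₁ j₁ * (g.2.1 : Matrix (Fin 2) (Fin 2) ℝ) i₂ j₂ *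
      (g.2.2.1 : Matrix (Fin 2) (Fin 2) ℝ) i₃ j₃ * (g.2.2.2 : Matrix (Fin 2) (Fin 2) ℝ) i₄ j₄ *
      T j₁ j₂ j₃ j₄

/-- The basis hypermatrix with a single `1` at position `(a,b,c,d)`; the sign `+` corresponds to
index `0` and the sign `−` to index `1`. -/
def bv (a b c d : Fin 2) : V := fun i₁ i₂ i₃ i₄ =>
  if i₁ = a ∧ i₂ = b ∧ i₃ = c ∧ i₄ = d then 1 else 0

/-- `v₁ = (−,+,+,−)` -/ noncomputable def v₁ : V := bv 1 0 0 1
/-- `v₂ = (+,+,−,+)` -/ noncomputable def v₂ : V := bv 0 0 1 0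
/-- `v₃ = (+,−,−,−)` -/ noncomputable def v₃ : V := bv 0 1 1 1
/-- `v₄ = (−,−,−,−)` -/ noncomputable def v₄ : V := bv 1 1 1 1


/-- The determinant-one diagonal matrix `diag(a, b)`, where `a * b = 1`. -/
def diagSL (a b : ℝ) (h : a * b = 1) : Matrix.SpecialLinearGroup (Fin 2) ℝ :=
  ⟨!![a, 0; 0, b], by simp [Matrix.det_fin_two, h]⟩

lemma diagSL_apply (a b : ℝ) (h : a * b = 1) (i j : Fin 2) :
    (diagSL a b h : Matrix (Fin 2) (Fin 2) ℝ) i j = if i = j then ![a, b] i else 0 := by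
  fin_cases i <;> fin_cases j <;> simp [diagSL]

lemma actG_diagSL (a b : Fin 4 → ℝ) (h : ∀ k, a k * b k = 1) (T : V) :
    actG (diagSL (a 0) (b 0) (h 0), diagSL (a 1) (b 1) (h 1), diagSL (a 2) (b 2) (h 2),
        diagSL (a 3) (b 3) (h 3)) T =
      fun i₁ i₂ i₃ i₄ => ![a 0, b 0] i₁ * ![a 1, b 1] i₂ * ![a 2, b 2] i₃ * ![a 3, b 3] i₄ *
        T i₁ i₂ i₃ i₄ := by
  funext i₁ i₂ i₃ i₄
  simp [actG, diagSL_apply]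

lemma mul_smul_bv (c : V) (u : ℝ) (a b d e : Fin 2) :
    c * u • bv a b d e = (c a b d e * u) • bv a b d e := by
  funext i₁ i₂ i₃ i₄
  simp only [bv, Pi.mul_apply, Pi.smul_apply, smul_eq_mul]
  split_ifs with h
  · obtain ⟨rfl, rfl, rfl, rfl⟩ := h
    ring
  · ring

lemma exists_sign_mul_exp {u : ℝ} (hu : u ≠ 0) :
    ∃ s x : ℝ, (s = 1 ∨ s = -1) ∧ u = s * Real.exp x := by
  rcases hu.lt_or_gt with h | h
  · exact ⟨-1, Real.log (-u), Or.inr rfl, by rw [Real.exp_log (neg_pos.2 h)]; ring⟩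
  · exact ⟨1, Real.log u, Or.inl rfl, by rw [Real.exp_log h]; ring⟩

lemma mul_eq_one_or_neg_one {s t : ℝ} (hs : s = 1 ∨ s = -1) (ht : t = 1 ∨ t = -1) :
    s * t = 1 ∨ s * t = -1 := by
  rcases hs with rfl | rfl <;> rcases ht with rfl | rfl <;> norm_num

/-- Every `u₁•v₁ + u₂•v₂ + u₃•v₃ + u₄•v₄` with all `uᵢ ≠ 0` is `G`-conjugate to one of the
eight sign representatives `v₁ ± v₂ ± v₃ ± v₄`. -/
theorem conjugate_to_sign_representative :
    ∀ u₁ u₂ u₃ u₄ : ℝ, u₁ * u₂ * u₃ * u₄ ≠ 0 →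
      ∃ s₂ s₃ s₄ : ℝ, (s₂ = 1 ∨ s₂ = -1) ∧ (s₃ = 1 ∨ s₃ = -1) ∧ (s₄ = 1 ∨ s₄ = -1) ∧
        ∃ g : G, actG g (u₁ • v₁ + u₂ • v₂ + u₃ • v₃ + u₄ • v₄)
          = v₁ + s₂ • v₂ + s₃ • v₃ + s₄ • v₄ := by
  intro u₁ u₂ u₃ u₄ hu
  obtain ⟨⟨⟨h₁, h₂⟩, h₃⟩, h₄⟩ : ((u₁ ≠ 0 ∧ u₂ ≠ 0) ∧ u₃ ≠ 0) ∧ u₄ ≠ 0 := by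
    simpa only [mul_ne_zero_iff] using hu
  obtain ⟨s₁, b₁, hs₁, rfl⟩ := exists_sign_mul_exp h₁
  obtain ⟨s₂, b₂, hs₂, rfl⟩ := exists_sign_mul_exp h₂
  obtain ⟨s₃, b₃, hs₃, rfl⟩ := exists_sign_mul_exp h₃
  obtain ⟨s₄, b₄, hs₄, rfl⟩ := exists_sign_mul_exp h₄
  have hss : s₁ * s₁ = 1 := by rcases hs₁ with rfl | rfl <;> norm_num
  let σ : Fin 4 → ℝ := ![s₁, 1, 1, 1]
  let x : Fin 4 → ℝ := ![(b₄ - b₃) / 2, -(b₁ + b₂) / 2, (b₂ + b₄) / 2, (b₁ + b₃) / 2]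
  have hσ (k : Fin 4) : σ k * σ k = 1 := by fin_cases k <;> simp [σ, hss]
  have hdet (k : Fin 4) : σ k * Real.exp (x k) * (σ k * Real.exp (-x k)) = 1 := by
    rw [mul_mul_mul_comm, hσ, ← Real.exp_add]
    simp
  have hexp {p q r t b : ℝ} (s : ℝ) (h : p + q + r + t + b = 0) :
      s₁ * Real.exp p * Real.exp q * Real.exp r * Real.exp t * (s * Real.exp b) = s₁ * s := by
    calc _ = s₁ * s * (Real.exp p * Real.exp q * Real.exp r * Real.exp t * Real.exp b) := by ring
      _ = s₁ * s := by simp only [← Real.exp_add, h, Real.exp_zero, mul_one]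
  refine ⟨s₁ * s₂, s₁ * s₃, s₁ * s₄, mul_eq_one_or_neg_one hs₁ hs₂,
    mul_eq_one_or_neg_one hs₁ hs₃, mul_eq_one_or_neg_one hs₁ hs₄, _,
    (actG_diagSL _ _ hdet _).trans ?_⟩
  let c : V := fun i₁ i₂ i₃ i₄ =>
    ![σ 0 * Real.exp (x 0), σ 0 * Real.exp (-x 0)] i₁ *
      ![σ 1 * Real.exp (x 1), σ 1 * Real.exp (-x 1)] i₂ *
      ![σ 2 * Real.exp (x 2), σ 2 * Real.exp (-x 2)] i₃ *
      ![σ 3 * Real.exp (x 3), σ 3 * Real.exp (-x 3)] i₄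
  have hc₁ : c 1 0 0 1 * (s₁ * Real.exp b₁) = 1 := by
    rw [← hss, ← hexp (p := -x 0) (q := x 1) (r := x 2) (t := -x 3) (b := b₁) s₁]
    · simp [c, σ]
    · simp [x]; ring
  have hc₂ : c 0 0 1 0 * (s₂ * Real.exp b₂) = s₁ * s₂ := by
    rw [← hexp (p := x 0) (q := x 1) (r := -x 2) (t := x 3) (b := b₂) s₂]
    · simp [c, σ]
    · simp [x]; ring
  have hc₃ : c 0 1 1 1 * (s₃ * Real.exp b₃) = s₁ * s₃ := by
    rw [← hexp (p := x 0) (q := -x 1) (r := -x 2) (t := -x 3) (b := b₃) s₃]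
    · simp [c, σ]
    · simp [x]; ring
  have hc₄ : c 1 1 1 1 * (s₄ * Real.exp b₄) = s₁ * s₄ := by
    rw [← hexp (p := -x 0) (q := -x 1) (r := -x 2) (t := -x 3) (b := b₄) s₄]
    · simp [c, σ]
    · simp [x]; ring
  calc _ = c * ((s₁ * Real.exp b₁) • v₁ + (s₂ * Real.exp b₂) • v₂ + (s₃ * Real.exp b₃) • v₃ +
        (s₄ * Real.exp b₄) • v₄) := rfl
    _ = _ := by
      simp only [mul_add, v₁, v₂, v₃, v₄, mul_smul_bv, hc₁, hc₂, hc₃, hc₄, one_smul]
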